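/- arXiv:1711.10276 — 5 statements merged into one kernel-verified Lean document; each statement's English description precedes it below -/
import Mathlib

section
/- The closed piecewise linear curve K_0 is a simple closed curve; that is, its standard loop parameterization p : [0,1] → ℝ³ (traversing the six edges in order with p(0) = p(1) = (0,9,20)) is injective on [0,1). -/
open Set Real

noncomputable section

/-- Points in ℝ³. -/
abbrev V3 : Type := Fin 3 → ℝ

/-- The point (x, y, z) ∈ ℝ³. -/
def pt (x y z : ℝ) : V3 := ![x, y, z]

/-- Standard parameterization on `[0,1]` of the piecewise linear curve through
`P 0, P 1, …, P m`, traversing the `m` edges in order at constant speed. -/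
def plPath (P : ℕ → V3) (m : ℕ) (t : ℝ) : V3 :=
  let s := t * m
  let i := ⌊s⌋.toNat
  (1 - (s - i)) • P i + (s - i) • P (i + 1)

/-- An ambient isotopy between subsets `X` and `Y` of ℝ³: a continuous map
`H : ℝ³ × [0,1] → ℝ³` with `H(·,0) = id`, each `H(·,t)` a homeomorphism of ℝ³
onto itself, and `H(X × {1}) = Y`. -/
def AmbientIsotopic (X Y : Set V3) : Prop :=
  ∃ H : V3 → ℝ → V3,
    ContinuousOn (fun p : V3 × ℝ => H p.1 p.2) (univ ×ˢ Icc (0 : ℝ) 1) ∧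
    (∀ x, H x 0 = x) ∧
    (∀ t ∈ Icc (0 : ℝ) 1, ∃ h : V3 ≃ₜ V3, ∀ x, H x t = h x) ∧
    (fun x => H x 1) '' X = Y

/-- The round circle {(x, y, 0) : x² + y² = 1}. -/
def unitCircle : Set V3 := {p : V3 | ∃ x y : ℝ, x ^ 2 + y ^ 2 = 1 ∧ p = pt x y 0}

/-- The standard trefoil, the image of
`t ↦ ((2 + cos 3t) cos 2t, (2 + cos 3t) sin 2t, sin 3t)` for `t ∈ [0, 2π]`. -/
def trefoil : Set V3 :=
  {p : V3 | ∃ t ∈ Icc (0 : ℝ) (2 * π),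
    p = pt ((2 + cos (3 * t)) * cos (2 * t)) ((2 + cos (3 * t)) * sin (2 * t)) (sin (3 * t))}

/-- Cyclic vertex function determined by a list of points. -/
def vertsOf (L : List V3) : ℕ → V3 := fun m => L.getD (m % L.length) 0

/-- The vertices of the closed PL curve K₀. -/
def K0verts : List V3 :=
  [pt 0 9 20, pt (-15) (-95) (-50), pt 40 80 (-20), pt (-10) (-60) 58,
   pt (-60) 30 20, pt 40 (-60) (-60)]

/-- The vertices of the closed PL curve K₁ (the vertex (−10,−60,58) of K₀ is
replaced by (10,−60,58)). -/
def K1verts : List V3 :=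
  [pt 0 9 20, pt (-15) (-95) (-50), pt 40 80 (-20), pt 10 (-60) 58,
   pt (-60) 30 20, pt 40 (-60) (-60)]

/-- The standard loop parameterization of K₀. -/
def K0loop : ℝ → V3 := plPath (vertsOf K0verts) 6

/-- The standard loop parameterization of K₁. -/
def K1loop : ℝ → V3 := plPath (vertsOf K1verts) 6

/-- The closed PL curve K₀ as a subset of ℝ³. -/
def K0 : Set V3 := K0loop '' Icc 0 1

/-- The closed PL curve K₁ as a subset of ℝ³. -/
def K1 : Set V3 := K1loop '' Icc 0 1

/-- The de Casteljau points `P_i^{(k)}` at parameter 1/2: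
`P_i^{(0)} = P_i` and `P_i^{(k)} = (P_i^{(k-1)} + P_{i+1}^{(k-1)})/2`. -/
def dcQ (P : ℕ → V3) : ℕ → ℕ → V3
  | 0, i => P i
  | k + 1, i => (1 / 2 : ℝ) • (dcQ P k i + dcQ P k (i + 1))

/-- Left half of one de Casteljau subdivision step at parameter 1/2:
`(P_0^{(0)}, P_0^{(1)}, …, P_0^{(n)})`. -/
def dcLeft (P : ℕ → V3) : ℕ → V3 := fun i => dcQ P i 0

/-- Right half of one de Casteljau subdivision step at parameter 1/2 on a
degree-`n` control polygon: `(P_0^{(n)}, P_1^{(n-1)}, …, P_n^{(0)})`. -/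
def dcRight (n : ℕ) (P : ℕ → V3) : ℕ → V3 := fun i => dcQ P (n - i) i

/-- The list of `2^k` sub-control polygons, in order, produced by `k` iterations
of de Casteljau subdivision at parameter 1/2 on a degree-`n` control polygon. -/
def subPolys (n : ℕ) : ℕ → (ℕ → V3) → List (ℕ → V3)
  | 0, P => [P]
  | k + 1, P => subPolys n k (dcLeft P) ++ subPolys n k (dcRight n P)

/-- Vertex function (cyclic) of the concatenation, in order, of a list of
degree-`n` control polygons whose consecutive endpoints agree. -/
def concatVerts (n : ℕ) (L : List (ℕ → V3)) : ℕ → V3 :=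
  fun m =>
    let m' := m % (n * L.length)
    (L.getD (m' / n) fun _ => 0) (m' % n)

/-- The standard loop parameterization of the closed PL curve obtained from the
degree-6 control polygon `Q` by `k` iterations of de Casteljau subdivision at
parameter 1/2 (concatenating the `2^k` sub-control polygons in order). -/
def Ksub (k : ℕ) (Q : ℕ → V3) : ℝ → V3 :=
  plPath (concatVerts 6 (subPolys 6 k Q)) (6 * 2 ^ k)

/-- The Bézier curve of degree `n` with control points `P 0, …, P n`. -/
def bezier (n : ℕ) (P : ℕ → V3) (t : ℝ) : V3 :=
  ∑ i ∈ Finset.range (n + 1), ((n.choose i : ℝ) * t ^ i * (1 - t) ^ (n - i)) • P i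

theorem pt_apply_zero (x y z : ℝ) : pt x y z 0 = x := rfl

theorem pt_apply_one (x y z : ℝ) : pt x y z 1 = y := rfl

theorem pt_apply_two (x y z : ℝ) : pt x y z 2 = z := rfl

/-- On its `i`-th parameter interval, `plPath P m` interpolates linearly from `P i` to
`P (i + 1)`. -/
theorem plPath_eq_of_eq_add (P : ℕ → V3) {m i : ℕ} {t a : ℝ} (ht : t * m = i + a)
    (ha₀ : 0 ≤ a) (ha₁ : a < 1) :
    plPath P m t = (1 - a) • P i + a • P (i + 1) := by
  have hfloor : ⌊(i : ℝ) + a⌋ = i := by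
    rw [Int.floor_eq_iff]
    constructor <;> push_cast <;> linarith
  simp [plPath, ht, hfloor]

/-- Every parameter in `[0,1)` lies on one of the `m` edges, at a local parameter in `[0,1)`. -/
theorem exists_mul_eq_add {m : ℕ} {t : ℝ} (hm : 0 < m) (ht : t ∈ Ico (0 : ℝ) 1) :
    ∃ i < m, ∃ a : ℝ, 0 ≤ a ∧ a < 1 ∧ t * m = i + a := by
  have hm' : (0 : ℝ) < m := by exact_mod_cast hm
  have h₀ : 0 ≤ t * m := mul_nonneg ht.1 hm'.le
  refine ⟨⌊t * m⌋₊, (Nat.floor_lt h₀).2 (by nlinarith [ht.2]), t * m - ⌊t * m⌋₊, ?_, ?_, by ring⟩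
  · linarith [Nat.floor_le h₀]
  · linarith [Nat.lt_floor_add_one (t * m)]

/-- The closed PL curve K₀ is a simple closed curve: its standard
loop parameterization is injective on `[0,1)`. -/
theorem K0_is_simple_closed : Set.InjOn K0loop (Ico 0 1) := by
  intro t ht u hu h
  obtain ⟨i, hi, a, ha₀, ha₁, hta⟩ := exists_mul_eq_add (m := 6) (by norm_num) ht
  obtain ⟨j, hj, b, hb₀, hb₁, hub⟩ := exists_mul_eq_add (m := 6) (by norm_num) hu
  rw [K0loop, plPath_eq_of_eq_add _ hta ha₀ ha₁, plPath_eq_of_eq_add _ hub hb₀ hb₁] at h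
  have hx := congrFun h 0
  have hy := congrFun h 1
  have hz := congrFun h 2
  simp only [Pi.add_apply, Pi.smul_apply, smul_eq_mul] at hx hy hz
  interval_cases i <;> interval_cases j <;>
    norm_num [vertsOf, K0verts, pt_apply_zero, pt_apply_one, pt_apply_two] at hx hy hz hta hub <;> linarith
end
end

section
/- There is an ambient isotopy between the curves K_0 and K_1. -/
open Set Real

noncomputable section

/-- An affine function vanishing at the neighbours of the moving vertex of K₀, equal to `1` at
that vertex, and negative at the three remaining vertices. -/
def separatingHeight (p : V3) : ℝ := 3 / 10 * p 0 + p 1 + 2 * p 2 - 52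

/-- Translation in the first coordinate by `c` times the positive part of `separatingHeight`. -/
def pushMap (c : ℝ) (p : V3) : V3 :=
  pt (p 0 + c * max 0 (separatingHeight p)) (p 1) (p 2)

lemma separatingHeight_pushMap (c : ℝ) (p : V3) :
    separatingHeight (pushMap c p) =
      separatingHeight p + 3 / 10 * c * max 0 (separatingHeight p) := by
  simp [separatingHeight, pushMap, pt]
  ring

lemma max_separatingHeight_pushMap {c : ℝ} (hc : 0 ≤ 1 + 3 / 10 * c) (p : V3) :
    max 0 (separatingHeight (pushMap c p)) =
      (1 + 3 / 10 * c) * max 0 (separatingHeight p) := by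
  rw [separatingHeight_pushMap]
  rcases le_total 0 (separatingHeight p) with h | h
  · rw [max_eq_right h, max_eq_right]
    · ring
    · nlinarith
  · rw [max_eq_left h, mul_zero, mul_zero, add_zero, max_eq_left h]

lemma pushMap_pushMap_of_eq {c d : ℝ} (hc : 0 ≤ 1 + 3 / 10 * c)
    (hcd : c + d * (1 + 3 / 10 * c) = 0) (p : V3) : pushMap d (pushMap c p) = p := by
  have h0 : p 0 + c * max 0 (separatingHeight p)
      + d * ((1 + 3 / 10 * c) * max 0 (separatingHeight p)) = p 0 := by
    linear_combination max 0 (separatingHeight p) * hcd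
  rw [pushMap, max_separatingHeight_pushMap hc]
  ext i
  fin_cases i
  · simpa [pushMap, pt] using h0
  · simp [pushMap, pt]
  · simp [pushMap, pt]

lemma continuous_pushMap : Continuous fun q : V3 × ℝ => pushMap q.2 q.1 := by
  refine continuous_pi fun i => ?_
  fin_cases i <;> simp [pushMap, pt, separatingHeight] <;> fun_prop

/-- For `0 ≤ c`, the map `pushMap c` is a homeomorphism of ℝ³. -/
def pushHomeomorph (c : ℝ) (hc : 0 ≤ c) : V3 ≃ₜ V3 where
  toFun := pushMap c
  invFun := pushMap (-c / (1 + 3 / 10 * c))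
  left_inv := pushMap_pushMap_of_eq (by positivity) (by field_simp; ring)
  right_inv := by
    have h : 1 + 3 / 10 * (-c / (1 + 3 / 10 * c)) = 1 / (1 + 3 / 10 * c) := by
      field_simp
      ring
    refine pushMap_pushMap_of_eq ?_ ?_ <;> rw [h]
    · positivity
    · ring
  continuous_toFun := continuous_pushMap.comp (continuous_id.prodMk continuous_const)
  continuous_invFun := continuous_pushMap.comp (continuous_id.prodMk continuous_const)

lemma pushMap_K0loop {t : ℝ} (ht : t ∈ Icc (0 : ℝ) 1) : pushMap 20 (K0loop t) = K1loop t := by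
  obtain ⟨h0, h1⟩ := ht
  have hs0 : (0 : ℝ) ≤ t * (6 : ℕ) := by positivity
  have hs1 : t * (6 : ℕ) ≤ 6 := by push_cast; linarith
  have hle : (⌊t * (6 : ℕ)⌋.toNat : ℝ) ≤ t * (6 : ℕ) := by
    rw [Int.floor_toNat]; exact Nat.floor_le hs0
  have hlt : t * (6 : ℕ) < (⌊t * (6 : ℕ)⌋.toNat : ℝ) + 1 := by
    rw [Int.floor_toNat]; exact Nat.lt_floor_add_one _
  simp only [K0loop, K1loop, plPath]
  generalize ⌊t * (6 : ℕ)⌋.toNat = i at hle hlt ⊢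
  generalize t * ((6 : ℕ) : ℝ) = s at hs0 hs1 hle hlt ⊢
  have hi : i ≤ 6 := by
    have : (i : ℝ) ≤ (6 : ℕ) := by push_cast; linarith
    exact_mod_cast this
  interval_cases i <;> norm_num at hle hlt <;> ext j <;> fin_cases j <;>
    simp [pushMap, separatingHeight, pt, vertsOf, K0verts, K1verts] <;>
    first
    | linarith
    | (rw [max_eq_right (by linarith)]; ring)

/-- There is an ambient isotopy between the curves K₀ and K₁. -/
theorem K0_ambientIsotopic_K1 : AmbientIsotopic K0 K1 := by
  refine ⟨fun p t => pushMap (20 * t) p, ?_, fun p => ?_, fun t ht => ?_, ?_⟩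
  · exact (continuous_pushMap.comp
      (continuous_fst.prodMk (continuous_const.mul continuous_snd))).continuousOn
  · ext i
    fin_cases i <;> simp [pushMap, pt]
  · exact ⟨pushHomeomorph (20 * t) (by linarith [ht.1]), fun _ => rfl⟩
  · simp only [mul_one]
    rw [K0, K1, image_image]
    exact image_congr fun t ht => pushMap_K0loop ht
end
end

section
/- The curve K_1 is the unknot: there is an ambient isotopy between K_1 and the round circle {(x,y,0) : x² + y² = 1}. -/
open Set Real

noncomputable section

theorem AmbientIsotopic.trans {X Y Z : Set V3} (h₁ : AmbientIsotopic X Y)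
    (h₂ : AmbientIsotopic Y Z) : AmbientIsotopic X Z := by
  obtain ⟨H, hc, h0, hh, rfl⟩ := h₁
  obtain ⟨G, gc, g0, gh, rfl⟩ := h₂
  have hmin : ∀ t ∈ Icc (0 : ℝ) 1, min 1 (2 * t) ∈ Icc (0 : ℝ) 1 := fun t ht =>
    ⟨le_min zero_le_one (by linarith [ht.1]), min_le_left _ _⟩
  have hmax : ∀ t ∈ Icc (0 : ℝ) 1, max 0 (2 * t - 1) ∈ Icc (0 : ℝ) 1 := fun t ht =>
    ⟨le_max_left _ _, max_le zero_le_one (by linarith [ht.2])⟩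
  refine ⟨fun x t => G (H x (min 1 (2 * t))) (max 0 (2 * t - 1)), ?_, ?_, ?_, ?_⟩
  · have inner : ContinuousOn (fun p : V3 × ℝ => H p.1 (min 1 (2 * p.2)))
        (univ ×ˢ Icc (0 : ℝ) 1) :=
      hc.comp (f := fun p : V3 × ℝ => (p.1, min 1 (2 * p.2))) (by fun_prop)
        fun p hp => ⟨trivial, hmin _ hp.2⟩
    exact gc.comp (f := fun p : V3 × ℝ => (H p.1 (min 1 (2 * p.2)), max 0 (2 * p.2 - 1)))
      (inner.prodMk (by fun_prop)) fun p hp => ⟨trivial, hmax _ hp.2⟩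
  · intro x
    norm_num [h0, g0]
  · intro t ht
    obtain ⟨h, eh⟩ := hh _ (hmin t ht)
    obtain ⟨g, eg⟩ := gh _ (hmax t ht)
    exact ⟨h.trans g, fun x => by simp [eh, eg]⟩
  · norm_num [image_image]

/-- Displacing each point along a fixed direction `d` by a continuous amount that does not
decrease too fast in that direction is a homeomorphism. -/
theorem exists_homeomorph_add_smul {φ : V3 → ℝ} {d : V3} {k : ℝ} (hk : k < 1)
    (hφ : Continuous φ) (hd : ∀ x c, 0 ≤ c → φ x ≤ φ (x + c • d) + k * c) :
    ∃ h : V3 ≃ₜ V3, ∀ x, x + φ x • d = h x := by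
  set f : V3 → ℝ → ℝ := fun y c => c - φ (y - c • d) with hf
  have slope : ∀ y a b, a ≤ b → (1 - k) * (b - a) ≤ f y b - f y a := by
    intro y a b hab
    have := hd (y - b • d) (b - a) (sub_nonneg.2 hab)
    rw [show y - b • d + (b - a) • d = y - a • d by module] at this
    simp only [hf]
    linarith
  have slope_abs : ∀ y a b, (1 - k) * |b - a| ≤ |f y b - f y a| := by
    intro y a b
    rcases le_total a b with hab | hab
    · rw [abs_of_nonneg (sub_nonneg.2 hab)]
      exact (slope y a b hab).trans (le_abs_self _)
    · rw [abs_sub_comm, abs_of_nonneg (sub_nonneg.2 hab), abs_sub_comm]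
      exact (slope y b a hab).trans (le_abs_self _)
  have fcont : ∀ y, Continuous (f y) := fun y => by simp only [hf]; fun_prop
  have hk' : 0 < 1 - k := sub_pos.2 hk
  have surj : ∀ y, ∃ c, f y c = 0 := by
    intro y
    set R := |f y 0| / (1 - k) with hR
    have hR0 : 0 ≤ R := by positivity
    have hRk : (1 - k) * R = |f y 0| := by rw [hR]; field_simp
    have h1 := slope y 0 R hR0
    have h2 := slope y (-R) 0 (by linarith)
    have := intermediate_value_Icc (by linarith : -R ≤ R) (fcont y).continuousOn
    obtain ⟨c, -, hc⟩ := this (show (0 : ℝ) ∈ Icc _ _ from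
      ⟨by linarith [le_abs_self (f y 0)], by linarith [neg_abs_le (f y 0)]⟩)
    exact ⟨c, hc⟩
  choose g hg using surj
  have uniq : ∀ y c, f y c = 0 → c = g y := by
    intro y c hc
    have := slope_abs y (g y) c
    rw [hc, hg, sub_zero, abs_zero] at this
    have : |c - g y| = 0 := le_antisymm (by nlinarith [abs_nonneg (c - g y)]) (abs_nonneg _)
    exact sub_eq_zero.1 (abs_eq_zero.1 this)
  have gcont : Continuous g := by
    refine continuous_iff_continuousAt.2 fun y₀ => ?_
    have hb : ∀ y, dist (g y) (g y₀) ≤ |f y (g y₀)| / (1 - k) := by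
      intro y
      have := slope_abs y (g y₀) (g y)
      rw [hg, zero_sub, abs_neg] at this
      rwa [Real.dist_eq, le_div_iff₀' hk']
    refine tendsto_iff_dist_tendsto_zero.2 (squeeze_zero (fun _ => dist_nonneg) hb ?_)
    have : Continuous fun y => |f y (g y₀)| / (1 - k) := by simp only [hf]; fun_prop
    simpa [hg] using this.tendsto y₀
  refine ⟨⟨⟨fun x => x + φ x • d, fun y => y - g y • d, fun x => ?_, fun y => ?_⟩,
    by fun_prop, by fun_prop⟩, fun x => rfl⟩
  · have : φ x = g (x + φ x • d) := uniq _ _ (by simp [hf])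
    simp [← this]
  · have := hg y
    simp only [hf, sub_eq_zero] at this
    simp [← this]

theorem ambientIsotopic_add_smul {φ : V3 → ℝ} {d : V3} {k : ℝ} (hk₀ : 0 ≤ k) (hk : k < 1)
    (hφ : Continuous φ) (hd : ∀ x c, 0 ≤ c → φ x ≤ φ (x + c • d) + k * c) (X : Set V3) :
    AmbientIsotopic X ((fun x => x + φ x • d) '' X) := by
  refine ⟨fun x t => x + (t * φ x) • d, by fun_prop, by simp, fun t ht => ?_, by simp⟩
  refine exists_homeomorph_add_smul hk (φ := fun x => t * φ x) (by fun_prop) fun x c hc => ?_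
  have h1 := mul_le_mul_of_nonneg_left (hd x c hc) ht.1
  have h2 := mul_le_mul_of_nonneg_right ht.2 (mul_nonneg hk₀ hc)
  linarith

/-- The concave bump cut out by a finite family of affine functions. -/
def tent {ι : Type*} [Fintype ι] [Nonempty ι] (ℓ : ι → V3 →ᵃ[ℝ] ℝ) (x : V3) : ℝ :=
  max 0 (Finset.univ.inf' Finset.univ_nonempty fun i => ℓ i x)

section Tent

variable {ι : Type*} [Fintype ι] [Nonempty ι] {ℓ : ι → V3 →ᵃ[ℝ] ℝ}

theorem continuous_tent : Continuous (tent ℓ) :=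
  continuous_const.max <| Continuous.finset_inf'_apply _ fun i _ =>
    (ℓ i).continuous_of_finiteDimensional

theorem tent_eq_zero {x : V3} {i : ι} (h : ℓ i x ≤ 0) : tent ℓ x = 0 :=
  max_eq_left ((Finset.inf'_le _ (Finset.mem_univ i)).trans h)

theorem tent_eq {x : V3} {r : ℝ} (hr : 0 ≤ r) (h : ∀ i, r ≤ ℓ i x) {i : ι} (hi : ℓ i x = r) :
    tent ℓ x = r := by
  have : (Finset.univ.inf' Finset.univ_nonempty fun i => ℓ i x) = r :=
    le_antisymm ((Finset.inf'_le _ (Finset.mem_univ i)).trans hi.le)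
      (Finset.le_inf' _ _ fun j _ => h j)
  rw [tent, this, max_eq_right hr]

theorem tent_le_tent_add {B M : V3} {k : ℝ} (hk : 0 ≤ k) (hB : ∀ i, ℓ i B = 1)
    (hM : ∀ i, 1 - k ≤ ℓ i M) (x : V3) {c : ℝ} (hc : 0 ≤ c) :
    tent ℓ x ≤ tent ℓ (x + c • (M - B)) + k * c := by
  have hkc : 0 ≤ k * c := mul_nonneg hk hc
  refine max_le (add_nonneg (le_max_left _ _) hkc) ?_
  obtain ⟨i, -, hi⟩ := Finset.exists_mem_eq_inf' Finset.univ_nonempty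
    fun i => ℓ i (x + c • (M - B))
  refine (Finset.inf'_le _ (Finset.mem_univ i)).trans ?_
  have hlin : ℓ i (x + c • (M - B)) = ℓ i x + c * (ℓ i M - ℓ i B) := by
    rw [add_comm, ← vadd_eq_add, AffineMap.map_vadd, map_smul, ← vsub_eq_sub M B,
      AffineMap.linearMap_vsub, vsub_eq_sub, smul_eq_mul, vadd_eq_add, add_comm]
  have h1 : ℓ i (x + c • (M - B)) ≤ tent ℓ (x + c • (M - B)) := hi ▸ le_max_right _ _
  have h2 := mul_le_mul_of_nonneg_left (hM i) hc
  rw [hlin, hB] at h1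
  linarith

theorem image_tent_segment_of_nonpos {X Y : V3} (d : V3) {i : ι} (hX : ℓ i X ≤ 0)
    (hY : ℓ i Y ≤ 0) : (fun x => x + tent ℓ x • d) '' segment ℝ X Y = segment ℝ X Y := by
  refine (image_congr fun x hx => ?_).trans (image_id _)
  obtain ⟨a, b, ha, hb, hab, rfl⟩ := hx
  rw [tent_eq_zero (i := i), zero_smul, add_zero, id]
  rw [Convex.combo_affine_apply hab, smul_eq_mul, smul_eq_mul]
  nlinarith

theorem image_tent_segment {P B M : V3} (hB : ∀ i, ℓ i B = 1) (hP : ∀ i, 0 ≤ ℓ i P) {i : ι}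
    (hi : ℓ i P = 0) :
    (fun x => x + tent ℓ x • (M - B)) '' segment ℝ P B = segment ℝ P M := by
  have key : ∀ a b : ℝ, 0 ≤ a → 0 ≤ b → a + b = 1 →
      a • P + b • B + tent ℓ (a • P + b • B) • (M - B) = a • P + b • M := by
    intro a b ha hb hab
    have val : ∀ j, ℓ j (a • P + b • B) = a * ℓ j P + b := fun j => by
      rw [Convex.combo_affine_apply hab, hB, smul_eq_mul, smul_eq_mul, mul_one]
    rw [tent_eq hb (fun j => ?_) (i := i) (by rw [val, hi, mul_zero, zero_add])]
    · module
    · rw [val]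
      nlinarith [mul_nonneg ha (hP j)]
  ext z
  constructor
  · rintro ⟨_, ⟨a, b, ha, hb, hab, rfl⟩, rfl⟩
    exact ⟨a, b, ha, hb, hab, (key a b ha hb hab).symm⟩
  · rintro ⟨a, b, ha, hb, hab, rfl⟩
    exact ⟨_, ⟨a, b, ha, hb, hab, rfl⟩, key a b ha hb hab⟩

end Tent

/-- The closed hexagonal curve with the given vertices. -/
def hexagon (a b c d e f : V3) : Set V3 :=
  segment ℝ a b ∪ segment ℝ b c ∪ segment ℝ c d ∪ segment ℝ d e ∪ segment ℝ e f ∪ segment ℝ f a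

theorem hexagon_rotate (a b c d e f : V3) : hexagon a b c d e f = hexagon b c d e f a := by
  simp only [hexagon]
  ac_rfl

/-- An affine function witnesses that the tetrahedron with vertices `P`, `Q`, `B`, `M` is
separated from the segment with endpoints `X`, `Y`, strictly at `B` and `M`. -/
def Separated (B M P Q X Y : V3) : Prop :=
  ∃ ℓ : V3 →ᵃ[ℝ] ℝ, 0 < ℓ B ∧ 0 < ℓ M ∧ 0 ≤ ℓ P ∧ 0 ≤ ℓ Q ∧ ℓ X ≤ 0 ∧ ℓ Y ≤ 0

theorem Separated.exists_eq_one {B M P Q X Y : V3} (h : Separated B M P Q X Y) :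
    ∃ ℓ : V3 →ᵃ[ℝ] ℝ, ℓ B = 1 ∧ 0 < ℓ M ∧ 0 ≤ ℓ P ∧ 0 ≤ ℓ Q ∧ ℓ X ≤ 0 ∧ ℓ Y ≤ 0 := by
  obtain ⟨ℓ, hB, hM, hP, hQ, hX, hY⟩ := h
  have := inv_pos.2 hB
  refine ⟨(ℓ B)⁻¹ • ℓ, ?_, ?_, ?_, ?_, ?_, ?_⟩ <;>
    simp only [AffineMap.coe_smul, Pi.smul_apply, smul_eq_mul]
  · exact inv_mul_cancel₀ hB.ne'
  · positivity
  · positivity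
  · positivity
  · exact mul_nonpos_of_nonneg_of_nonpos this.le hX
  · exact mul_nonpos_of_nonneg_of_nonpos this.le hY

/-- Moving a vertex of a hexagon while avoiding the four edges not adjacent to it. -/
theorem ambientIsotopic_hexagon {a b c d e f : V3} (m : V3)
    (h₁ : Separated a m f b b c) (h₂ : Separated a m f b c d)
    (h₃ : Separated a m f b d e) (h₄ : Separated a m f b e f) :
    AmbientIsotopic (hexagon a b c d e f) (hexagon m b c d e f) := by
  obtain ⟨ℓ₁, ha₁, hm₁, hf₁, hb₁, hX₁, hY₁⟩ := h₁.exists_eq_one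
  obtain ⟨ℓ₂, ha₂, hm₂, hf₂, hb₂, hX₂, hY₂⟩ := h₂.exists_eq_one
  obtain ⟨ℓ₃, ha₃, hm₃, hf₃, hb₃, hX₃, hY₃⟩ := h₃.exists_eq_one
  obtain ⟨ℓ₄, ha₄, hm₄, hf₄, hb₄, hX₄, hY₄⟩ := h₄.exists_eq_one
  set ℓ : Fin 4 → V3 →ᵃ[ℝ] ℝ := ![ℓ₁, ℓ₂, ℓ₃, ℓ₄]
  have ha : ∀ i, ℓ i a = 1 := by simp [ℓ, Fin.forall_fin_succ, *]
  have hm : ∀ i, 0 < ℓ i m := by simp [ℓ, Fin.forall_fin_succ, *]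
  have hf : ∀ i, 0 ≤ ℓ i f := by simp [ℓ, Fin.forall_fin_succ, *]
  have hb : ∀ i, 0 ≤ ℓ i b := by simp [ℓ, Fin.forall_fin_succ, *]
  obtain ⟨j, -, hj⟩ := Finset.exists_mem_eq_inf' (Finset.univ_nonempty (α := Fin 4))
    fun i => ℓ i m
  have hmin : ∀ i, ℓ j m ≤ ℓ i m := fun i => hj ▸ Finset.inf'_le _ (Finset.mem_univ i)
  convert ambientIsotopic_add_smul (φ := tent ℓ) (d := m - a) (k := 1 - min 1 (ℓ j m))
    (by simp) (by simp [hm]) continuous_tent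
    (fun x c hc => tent_le_tent_add (by simp) ha (fun i => by simp [hmin]) x hc)
    (hexagon a b c d e f) using 1
  simp only [hexagon, image_union]
  rw [segment_symm ℝ a b, image_tent_segment ha hb (i := 0) (le_antisymm hX₁ hb₁),
    image_tent_segment ha hf (i := 3) (le_antisymm hY₄ hf₄), segment_symm ℝ b m,
    image_tent_segment_of_nonpos _ (i := 0) hX₁ hY₁,
    image_tent_segment_of_nonpos _ (i := 1) hX₂ hY₂,
    image_tent_segment_of_nonpos _ (i := 2) hX₃ hY₃,
    image_tent_segment_of_nonpos _ (i := 3) hX₄ hY₄]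

/-- The affine function `(x, y, z) ↦ p x + q y + r z + s`. -/
def affineForm (p q r s : ℝ) : V3 →ᵃ[ℝ] ℝ :=
  (dotProductBilin ℝ ℝ (pt p q r)).toAffineMap + AffineMap.const ℝ V3 s

theorem affineForm_pt (p q r s x y z : ℝ) :
    affineForm p q r s (pt x y z) = p * x + q * y + r * z + s := by
  simp [affineForm, dotProductBilin, pt, dotProduct, Fin.sum_univ_three]

theorem image_plPath (P : ℕ → V3) {m : ℕ} (hm : 0 < m) :
    plPath P m '' Icc 0 1 = ⋃ i < m, segment ℝ (P i) (P (i + 1)) := by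
  have hm' : (0 : ℝ) < m := Nat.cast_pos.2 hm
  have val : ∀ (i : ℕ) (τ : ℝ), 0 ≤ τ → τ < 1 →
      plPath P m ((i + τ) / m) = (1 - τ) • P i + τ • P (i + 1) := by
    intro i τ h0 h1
    have hfl : ⌊(i : ℝ) + τ⌋ = i := Int.floor_eq_iff.2 ⟨by simpa using h0, by simpa using h1⟩
    simp only [plPath, div_mul_cancel₀ _ hm'.ne', hfl, Int.toNat_natCast, add_sub_cancel_left]
  have val_nat : ∀ i : ℕ, plPath P m (i / m) = P i := fun i => by
    simpa using val i 0 le_rfl one_pos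
  ext z
  simp only [mem_iUnion, exists_prop]
  constructor
  · rintro ⟨t, ⟨h0, h1⟩, rfl⟩
    rcases h1.eq_or_lt with rfl | h1
    · obtain ⟨k, rfl⟩ := Nat.exists_eq_succ_of_ne_zero hm.ne'
      refine ⟨k, k.lt_succ_self, ?_⟩
      have := val_nat (k + 1)
      rw [div_self hm'.ne'] at this
      exact this ▸ right_mem_segment ℝ _ _
    · have hs : 0 ≤ t * m := by positivity
      have h := val ⌊t * m⌋₊ (t * m - ⌊t * m⌋₊) (sub_nonneg.2 (Nat.floor_le hs))
        (by linarith [Nat.lt_floor_add_one (t * m)])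
      rw [add_sub_cancel, mul_div_cancel_right₀ _ hm'.ne'] at h
      refine ⟨⌊t * m⌋₊, (Nat.floor_lt hs).2 (by nlinarith), ?_⟩
      rw [h]
      exact ⟨_, _, by linarith [Nat.lt_floor_add_one (t * m)],
        sub_nonneg.2 (Nat.floor_le hs), by ring, rfl⟩
  · rintro ⟨i, hi, a, τ, ha, hτ, hab, rfl⟩
    obtain rfl : a = 1 - τ := by linarith
    have hi' : (i : ℝ) + 1 ≤ m := by exact_mod_cast hi
    refine ⟨(i + τ) / m, ⟨by positivity, (div_le_one hm').2 (by linarith)⟩, ?_⟩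
    rcases (sub_nonneg.1 ha).eq_or_lt with rfl | h1
    · simpa using val_nat (i + 1)
    · exact val i τ hτ h1

theorem K1_eq_hexagon : K1 = hexagon (pt 0 9 20) (pt (-15) (-95) (-50)) (pt 40 80 (-20))
    (pt 10 (-60) 58) (pt (-60) 30 20) (pt 40 (-60) (-60)) := by
  rw [K1, K1loop, image_plPath _ (by norm_num)]
  simp only [biUnion_lt_succ, Nat.not_lt_zero, iUnion_of_empty, iUnion_empty, empty_union]
  simp [hexagon, vertsOf, K1verts]

/-- Radially rescaling each point by a positive bounded factor, continuous off the origin, is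
continuous. -/
theorem continuous_smul_self {μ : V3 → ℝ} {C : ℝ} (hC : ∀ x, |μ x| ≤ C)
    (hμ : ∀ x ≠ 0, ContinuousAt μ x) : Continuous fun x => μ x • x := by
  refine continuous_iff_continuousAt.2 fun x => ?_
  rcases eq_or_ne x 0 with rfl | hx
  · have hb : ∀ y : V3, ‖μ y • y‖ ≤ C * ‖y‖ := fun y => by
      rw [norm_smul]
      exact mul_le_mul_of_nonneg_right (hC y) (norm_nonneg y)
    have : Filter.Tendsto (fun y : V3 => C * ‖y‖) (nhds 0) (nhds 0) := by
      have : Continuous fun y : V3 => C * ‖y‖ := by fun_prop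
      simpa using this.tendsto 0
    simpa [ContinuousAt] using squeeze_zero_norm hb this
  · exact (hμ x hx).smul continuousAt_id

theorem ambientIsotopic_smul_self {μ : V3 → ℝ} {m C : ℝ} (hm : 0 < m)
    (hμm : ∀ x, m ≤ μ x) (hμC : ∀ x, μ x ≤ C) (hμ : ∀ x ≠ 0, ContinuousAt μ x)
    (hom : ∀ (c : ℝ) x, 0 < c → μ (c • x) = μ x) (X : Set V3) :
    AmbientIsotopic X ((fun x => μ x • x) '' X) := by
  have hpos : ∀ x, 0 < μ x := fun x => hm.trans_le (hμm x)
  have hcont : Continuous fun x => μ x • x :=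
    continuous_smul_self (C := C) (fun x => by rw [abs_of_pos (hpos x)]; exact hμC x) hμ
  refine ⟨fun x t => (1 - t) • x + t • μ x • x, ?_, by simp, fun t ht => ?_, by simp⟩
  · have : Continuous fun p : V3 × ℝ => μ p.1 • p.1 := hcont.comp continuous_fst
    fun_prop
  set ν : V3 → ℝ := fun x => (1 - t) + t * μ x with hν
  have hνm : ∀ x, min 1 m ≤ ν x := fun x => by
    have h1 := mul_le_mul_of_nonneg_left (min_le_left 1 m) (sub_nonneg.2 ht.2)
    have h2 := mul_le_mul_of_nonneg_left ((min_le_right 1 m).trans (hμm x)) ht.1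
    simp only [hν]
    linarith
  have hm1 : 0 < min 1 m := lt_min one_pos hm
  have hνpos : ∀ x, 0 < ν x := fun x => hm1.trans_le (hνm x)
  have hνhom : ∀ (c : ℝ) x, 0 < c → ν (c • x) = ν x := fun c x hc => by
    simp only [hν, hom c x hc]
  have hνcont : ∀ x ≠ 0, ContinuousAt ν x := fun x hx =>
    continuousAt_const.add (continuousAt_const.mul (hμ x hx))
  have inv_cont : Continuous fun x => (ν x)⁻¹ • x :=
    continuous_smul_self (C := (min 1 m)⁻¹)
      (fun x => by
        rw [abs_of_pos (inv_pos.2 (hνpos x))]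
        exact inv_anti₀ hm1 (hνm x))
      fun x hx => (hνcont x hx).inv₀ (hνpos x).ne'
  have h_eq : ∀ x, (1 - t) • x + t • μ x • x = ν x • x := fun x => by
    simp only [hν]
    module
  refine ⟨⟨⟨fun x => ν x • x, fun x => (ν x)⁻¹ • x, fun x => ?_, fun x => ?_⟩, ?_, inv_cont⟩,
    h_eq⟩
  · simp only [hνhom _ x (hνpos x)]
    rw [inv_smul_smul₀ (hνpos x).ne']
  · simp only [hνhom _ x (inv_pos.2 (hνpos x))]
    rw [smul_inv_smul₀ (hνpos x).ne']
  · change Continuous fun x => ν x • x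
    simp only [← h_eq]
    fun_prop

theorem segment_pt_fst (a b y z : ℝ) :
    segment ℝ (pt a y z) (pt b y z) = (fun x => pt x y z) '' uIcc a b := by
  rw [← segment_eq_uIcc]
  ext p
  constructor
  · rintro ⟨s, t, hs, ht, hst, rfl⟩
    refine ⟨s • a + t • b, ⟨s, t, hs, ht, hst, rfl⟩, ?_⟩
    ext i
    fin_cases i <;> simp [pt, ← add_mul, hst]
  · rintro ⟨_, ⟨s, t, hs, ht, hst, rfl⟩, rfl⟩
    refine ⟨s, t, hs, ht, hst, ?_⟩
    ext i
    fin_cases i <;> simp [pt, ← add_mul, hst]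

theorem segment_pt_snd (x a b z : ℝ) :
    segment ℝ (pt x a z) (pt x b z) = (fun y => pt x y z) '' uIcc a b := by
  rw [← segment_eq_uIcc]
  ext p
  constructor
  · rintro ⟨s, t, hs, ht, hst, rfl⟩
    refine ⟨s • a + t • b, ⟨s, t, hs, ht, hst, rfl⟩, ?_⟩
    ext i
    fin_cases i <;> simp [pt, ← add_mul, hst]
  · rintro ⟨_, ⟨s, t, hs, ht, hst, rfl⟩, rfl⟩
    refine ⟨s, t, hs, ht, hst, ?_⟩
    ext i
    fin_cases i <;> simp [pt, ← add_mul, hst]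

theorem exists_eq_pt_zero {p : V3} (h : p 2 = 0) : ∃ x y, p = pt x y 0 := by
  refine ⟨p 0, p 1, ?_⟩
  ext i
  fin_cases i <;> simp [pt, h]

theorem norm_pt_zero (x y : ℝ) : ‖pt x y 0‖ = max |x| |y| := by
  refine le_antisymm ((pi_norm_le_iff_of_nonneg (le_max_of_le_left (abs_nonneg x))).2 fun i => ?_)
    (max_le (norm_le_pi_norm (pt x y 0) 0) (norm_le_pi_norm (pt x y 0) 1))
  fin_cases i <;> simp [pt]

/-- The square of side `100` in the `xy`-plane, centred at the origin. -/
def squareCurve : Set V3 := {p : V3 | p 2 = 0 ∧ ‖p‖ = 50}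

theorem pt_mem_squareCurve {x y : ℝ} :
    pt x y 0 ∈ squareCurve ↔ max |x| |y| = 50 := by
  rw [← norm_pt_zero]
  simp [squareCurve, pt]

theorem hexagon_eq_squareCurve :
    hexagon (pt 50 45 0) (pt 50 (-50) 0) (pt (-50) (-50) 0) (pt (-50) 50 0) (pt (-5) 50 0)
      (pt 50 50 0) = squareCurve := by
  simp only [hexagon, segment_pt_fst, segment_pt_snd]
  apply Subset.antisymm
  · simp only [union_subset_iff, image_subset_iff]
    refine ⟨⟨⟨⟨⟨?_, ?_⟩, ?_⟩, ?_⟩, ?_⟩, ?_⟩ <;> intro x hx <;>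
      rw [mem_uIcc] at hx <;> rw [mem_preimage, pt_mem_squareCurve]
    all_goals
      have : |x| ≤ 50 := abs_le.2 (by
        constructor <;> rcases hx with hx | hx <;> linarith [hx.1, hx.2])
      norm_num [this]
  · intro p hp
    obtain ⟨x, y, rfl⟩ := exists_eq_pt_zero hp.1
    rw [pt_mem_squareCurve] at hp
    have hx := abs_le.1 ((le_max_left _ _).trans hp.le)
    have hy := abs_le.1 ((le_max_right _ _).trans hp.le)
    simp only [mem_union, mem_image, mem_uIcc]
    rcases max_choice |x| |y| with h | h <;> rw [h] at hp <;>
      rcases eq_or_eq_neg_of_abs_eq hp with rfl | rfl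
    · rcases le_total y 45 with h | h
      · exact .inl <| .inl <| .inl <| .inl <| .inl ⟨y, .inr ⟨hy.1, h⟩, rfl⟩
      · exact .inr ⟨y, .inr ⟨h, hy.2⟩, rfl⟩
    · exact .inl <| .inl <| .inl <| .inr ⟨y, .inl hy, rfl⟩
    · rcases le_total x (-5) with h | h
      · exact .inl <| .inl <| .inr ⟨x, .inl ⟨hx.1, h⟩, rfl⟩
      · exact .inl <| .inr ⟨x, .inl ⟨h, hx.2⟩, rfl⟩
    · exact .inl <| .inl <| .inl <| .inl <| .inr ⟨x, .inr hx, rfl⟩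

/-- The Euclidean norm on `V3`, whose `‖·‖` is the supremum norm. -/
def euclideanNorm (p : V3) : ℝ := √(p 0 ^ 2 + p 1 ^ 2 + p 2 ^ 2)

theorem norm_le_euclideanNorm (p : V3) : ‖p‖ ≤ euclideanNorm p := by
  refine (pi_norm_le_iff_of_nonneg (sqrt_nonneg _)).2 fun i => abs_le_sqrt ?_
  fin_cases i <;> simp <;> nlinarith [sq_nonneg (p 0), sq_nonneg (p 1), sq_nonneg (p 2)]

theorem euclideanNorm_le (p : V3) : euclideanNorm p ≤ 2 * ‖p‖ := by
  have h : ∀ i, p i ^ 2 ≤ ‖p‖ ^ 2 := fun i => sq_le_sq' (neg_le_of_abs_le (norm_le_pi_norm p i))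
    ((le_abs_self _).trans (norm_le_pi_norm p i))
  refine sqrt_le_iff.2 ⟨by positivity, ?_⟩
  nlinarith [h 0, h 1, h 2, sq_nonneg ‖p‖]

theorem euclideanNorm_smul {c : ℝ} (hc : 0 ≤ c) (p : V3) :
    euclideanNorm (c • p) = c * euclideanNorm p := by
  simp only [euclideanNorm, Pi.smul_apply, smul_eq_mul, mul_pow, ← mul_add]
  rw [sqrt_mul (sq_nonneg c), sqrt_sq hc]

theorem euclideanNorm_pos {p : V3} (hp : p ≠ 0) : 0 < euclideanNorm p :=
  (norm_pos_iff.2 hp).trans_le (norm_le_euclideanNorm p)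

theorem continuous_euclideanNorm : Continuous euclideanNorm := by
  unfold euclideanNorm
  fun_prop

theorem squareCurve_ambientIsotopic_unitCircle : AmbientIsotopic squareCurve unitCircle := by
  classical
  set μ : V3 → ℝ := fun x => if x = 0 then 1 / 50 else ‖x‖ / (50 * euclideanNorm x)
  have hμ : ∀ x ≠ 0, μ x = ‖x‖ / (50 * euclideanNorm x) := fun x hx => if_neg hx
  convert ambientIsotopic_smul_self (μ := μ) (m := 1 / 100) (C := 1 / 50) (by norm_num)
    ?_ ?_ ?_ ?_ squareCurve using 1
  · apply Subset.antisymm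
    · rintro _ ⟨x, y, hxy, rfl⟩
      set q := pt x y 0 with hq
      have hE : euclideanNorm q = 1 := by simp [euclideanNorm, hq, pt, hxy]
      have hq0 : q ≠ 0 := by
        intro h
        simp [h, euclideanNorm] at hE
      have hn : 0 < ‖q‖ := norm_pos_iff.2 hq0
      have hc : 0 < 50 / ‖q‖ := by positivity
      refine ⟨(50 / ‖q‖) • q, ⟨by simp [hq, pt], ?_⟩, ?_⟩
      · rw [norm_smul, Real.norm_of_nonneg hc.le]
        field_simp
      · simp only
        rw [hμ _ (smul_ne_zero hc.ne' hq0), euclideanNorm_smul hc.le, norm_smul,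
          Real.norm_of_nonneg hc.le, hE, smul_smul]
        convert one_smul ℝ q using 2
        field_simp
    · rintro _ ⟨p, ⟨h2, hp⟩, rfl⟩
      have hp0 : p ≠ 0 := norm_pos_iff.1 (by rw [hp]; norm_num)
      have hE := euclideanNorm_pos hp0
      have hsq : euclideanNorm p ^ 2 = p 0 ^ 2 + p 1 ^ 2 := by
        rw [euclideanNorm, h2, sq_sqrt (by positivity)]
        ring
      refine ⟨p 0 / euclideanNorm p, p 1 / euclideanNorm p, ?_, ?_⟩
      · field_simp
        exact hsq.symm
      · simp only
        rw [hμ p hp0, hp]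
        ext i
        fin_cases i <;> simp [pt, h2] <;> field_simp
  · intro x
    rcases eq_or_ne x 0 with rfl | hx
    · norm_num [μ]
    · have := euclideanNorm_pos hx
      rw [hμ x hx, div_le_div_iff₀ (by norm_num) (by positivity)]
      linarith [euclideanNorm_le x]
  · intro x
    rcases eq_or_ne x 0 with rfl | hx
    · norm_num [μ]
    · have := euclideanNorm_pos hx
      rw [hμ x hx, div_le_div_iff₀ (by positivity) (by norm_num)]
      linarith [norm_le_euclideanNorm x]
  · intro x hx
    have h0 := (euclideanNorm_pos hx).ne'
    have hc := continuous_euclideanNorm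
    have : ContinuousAt (fun x => ‖x‖ / (50 * euclideanNorm x)) x :=
      continuousAt_id.norm.div (continuousAt_const.mul hc.continuousAt) (by positivity)
    exact this.congr ((isOpen_ne.eventually_mem hx).mono fun y hy => (hμ y hy).symm)
  · intro c x hc
    rcases eq_or_ne x 0 with rfl | hx
    · simp
    · rw [hμ x hx, hμ _ (smul_ne_zero hc.ne' hx), euclideanNorm_smul hc.le, norm_smul,
        Real.norm_of_nonneg hc.le, mul_left_comm, mul_div_mul_left _ _ hc.ne']

theorem separated_of_affineForm (p q r s : ℝ)
    {x₁ y₁ z₁ x₂ y₂ z₂ x₃ y₃ z₃ x₄ y₄ z₄ x₅ y₅ z₅ x₆ y₆ z₆ : ℝ}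
    (h₁ : 0 < p * x₁ + q * y₁ + r * z₁ + s := by norm_num)
    (h₂ : 0 < p * x₂ + q * y₂ + r * z₂ + s := by norm_num)
    (h₃ : 0 ≤ p * x₃ + q * y₃ + r * z₃ + s := by norm_num)
    (h₄ : 0 ≤ p * x₄ + q * y₄ + r * z₄ + s := by norm_num)
    (h₅ : p * x₅ + q * y₅ + r * z₅ + s ≤ 0 := by norm_num)
    (h₆ : p * x₆ + q * y₆ + r * z₆ + s ≤ 0 := by norm_num) :
    Separated (pt x₁ y₁ z₁) (pt x₂ y₂ z₂) (pt x₃ y₃ z₃) (pt x₄ y₄ z₄) (pt x₅ y₅ z₅)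
      (pt x₆ y₆ z₆) :=
  ⟨affineForm p q r s, by simpa only [affineForm_pt] using ⟨h₁, h₂, h₃, h₄, h₅, h₆⟩⟩

/-- K₁ is the unknot: there is an ambient isotopy between K₁ and
the round circle {(x,y,0) : x² + y² = 1}. -/
theorem K1_is_unknot : AmbientIsotopic K1 unitCircle := by
  refine AmbientIsotopic.trans ?_ squareCurve_ambientIsotopic_unitCircle
  rw [K1_eq_hexagon, ← hexagon_eq_squareCurve]
  refine (ambientIsotopic_hexagon (pt 50 (-50) 0)
    (separated_of_affineForm 1 (-1) 2 20)
    (separated_of_affineForm (-1) (-1) (-2) 66)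
    (separated_of_affineForm 1 0 (-1) 48)
    (separated_of_affineForm 0 (-1) 1 0)).trans ?_
  rw [hexagon_rotate, hexagon_rotate, hexagon_rotate]
  refine (ambientIsotopic_hexagon (pt (-5) 50 0)
    (separated_of_affineForm 1 1 1 10)
    (separated_of_affineForm (-1) 0 0 40)
    (separated_of_affineForm 0 1 1 50)
    (separated_of_affineForm 0 0 1 20)).trans ?_
  rw [hexagon_rotate]
  refine (ambientIsotopic_hexagon (pt 50 50 0)
    (separated_of_affineForm 0 1 (-1) 0)
    (separated_of_affineForm 0 1 (-1) 45)
    (separated_of_affineForm 3 (-2) 6 155)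
    (separated_of_affineForm 1 (-1) 2 55)).trans ?_
  rw [hexagon_rotate, hexagon_rotate, hexagon_rotate]
  refine (ambientIsotopic_hexagon (pt (-50) (-50) 0)
    (separated_of_affineForm 1 (-1) 0 40)
    (separated_of_affineForm 0 (-1) (-2) 50)
    (separated_of_affineForm (-2) 0 1 100)
    (separated_of_affineForm (-1) 1 0 100)).trans ?_
  rw [hexagon_rotate]
  refine (ambientIsotopic_hexagon (pt (-50) 50 0)
    (separated_of_affineForm (-1) 0 (-3) (-5))
    (separated_of_affineForm (-1) 1 0 0)
    (separated_of_affineForm 0 1 0 50)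
    (separated_of_affineForm 0 1 0 50)).trans ?_
  rw [hexagon_rotate, hexagon_rotate, hexagon_rotate]
  exact ambientIsotopic_hexagon (pt 50 45 0)
    (separated_of_affineForm 0 1 (-1) 50)
    (separated_of_affineForm 1 0 0 50)
    (separated_of_affineForm 0 (-1) 0 50)
    (separated_of_affineForm 0 (-1) 0 50)
end
end

section
/- The closed piecewise linear curve K_{0,4}, obtained from K_0 by 4 iterations of de Casteljau subdivision at parameter 1/2, is a simple closed curve; that is, its standard loop parameterization is injective on [0,1). -/
open Set Real

noncomputable section

/-- The control polygon of the left half of a degree-6 polynomial with Bézier coefficients `l`,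
scaled by `64`. -/
def leftHalf : List ℤ → List ℤ
  | [a, b, c, d, e, f, g] =>
    [64 * a, 32 * (a + b), 16 * (a + 2 * b + c), 8 * (a + 3 * b + 3 * c + d),
      4 * (a + 4 * b + 6 * c + 4 * d + e), 2 * (a + 5 * b + 10 * c + 10 * d + 5 * e + f),
      a + 6 * b + 15 * c + 20 * d + 15 * e + 6 * f + g]
  | _ => []

/-- The control polygon of the right half of a degree-6 polynomial with Bézier coefficients `l`,
scaled by `64`. -/
def rightHalf (l : List ℤ) : List ℤ := (leftHalf l.reverse).reverse

/-- Integer version of `subPolys 6`, for a single coordinate, scaled by `64 ^ k`. -/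
def intSubPolys : ℕ → List ℤ → List (List ℤ)
  | 0, l => [l]
  | k + 1, l => intSubPolys k (leftHalf l) ++ intSubPolys k (rightHalf l)

/-- The `j`-th coordinates of the degree-6 control polygon `P`, scaled by `c`, are listed in `l`. -/
def Represents (c : ℝ) (j : Fin 3) (P : ℕ → V3) (l : List ℤ) : Prop :=
  l.length = 7 ∧ ∀ i < 7, c * P i j = (l.getD i 0 : ℤ)

theorem Represents.exists_eq {c : ℝ} {j : Fin 3} {P : ℕ → V3} {l : List ℤ}
    (h : Represents c j P l) : ∃ x₀ x₁ x₂ x₃ x₄ x₅ x₆ : ℤ, l = [x₀, x₁, x₂, x₃, x₄, x₅, x₆] ∧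
      c * P 0 j = x₀ ∧ c * P 1 j = x₁ ∧ c * P 2 j = x₂ ∧ c * P 3 j = x₃ ∧ c * P 4 j = x₄ ∧
      c * P 5 j = x₅ ∧ c * P 6 j = x₆ := by
  obtain ⟨hl, h⟩ := h
  match l, hl with
  | [x₀, x₁, x₂, x₃, x₄, x₅, x₆], _ =>
    exact ⟨x₀, x₁, x₂, x₃, x₄, x₅, x₆, rfl, h 0 (by simp), h 1 (by simp), h 2 (by simp),
      h 3 (by simp), h 4 (by simp), h 5 (by simp), h 6 (by simp)⟩

theorem Represents.dcLeft {c : ℝ} {j : Fin 3} {P : ℕ → V3} {l : List ℤ}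
    (h : Represents c j P l) : Represents (c * 64) j (dcLeft P) (leftHalf l) := by
  obtain ⟨x₀, x₁, x₂, x₃, x₄, x₅, x₆, rfl, h₀, h₁, h₂, h₃, h₄, h₅, h₆⟩ := h.exists_eq
  refine ⟨rfl, fun i hi => ?_⟩
  interval_cases i <;>
    simp [_root_.dcLeft, dcQ, leftHalf, ← h₀, ← h₁, ← h₂, ← h₃, ← h₄, ← h₅, ← h₆] <;> ring

theorem Represents.dcRight {c : ℝ} {j : Fin 3} {P : ℕ → V3} {l : List ℤ}
    (h : Represents c j P l) : Represents (c * 64) j (dcRight 6 P) (rightHalf l) := by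
  obtain ⟨x₀, x₁, x₂, x₃, x₄, x₅, x₆, rfl, h₀, h₁, h₂, h₃, h₄, h₅, h₆⟩ := h.exists_eq
  refine ⟨rfl, fun i hi => ?_⟩
  interval_cases i <;>
    simp [_root_.dcRight, dcQ, rightHalf, leftHalf, ← h₀, ← h₁, ← h₂, ← h₃, ← h₄, ← h₅,
      ← h₆] <;> ring

theorem Represents.subPolys {j : Fin 3} (k : ℕ) {c : ℝ} {P : ℕ → V3} {l : List ℤ}
    (h : Represents c j P l) :
    List.Forall₂ (Represents (c * 64 ^ k) j) (subPolys 6 k P) (intSubPolys k l) := by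
  induction k generalizing c P l with
  | zero => simpa [_root_.subPolys, intSubPolys] using h
  | succ k ih =>
    rw [pow_succ', ← mul_assoc]
    exact List.rel_append (ih h.dcLeft) (ih h.dcRight)

theorem mul_concatVerts_eq {c : ℝ} {j : Fin 3} {L : List (ℕ → V3)} {M : List (List ℤ)}
    (h : List.Forall₂ (Represents c j) L M) (hL : L ≠ []) (m : ℕ) :
    c * concatVerts 6 L m j =
      ((M.getD (m % (6 * M.length) / 6) []).getD (m % (6 * M.length) % 6) 0 : ℤ) := by
  have hlen := h.length_eq
  have hpos : 0 < L.length := List.length_pos_iff.2 hL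
  have hm : m % (6 * L.length) / 6 < L.length :=
    Nat.div_lt_of_lt_mul (Nat.mod_lt _ (by lia))
  have hm' : m % (6 * L.length) / 6 < M.length := hlen ▸ hm
  simp only [concatVerts, ← hlen]
  rw [List.getD_eq_getElem L _ hm, List.getD_eq_getElem M _ hm']
  exact (h.get hm hm').2 _ ((Nat.mod_lt _ (by norm_num)).trans (by norm_num))

/-- The vertices of `K₀,₄` scaled by `2 ^ 24`, with the starting vertex repeated at the end. -/
def K04verts : List (ℤ × ℤ × ℤ) :=
  [(0, 150994944, 335544320), (-15728640, 41943040, 262144000), (-26869760, -48824320, 195297280),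
   (-34140160, -123740160, 134791168), (-38184960, -184945920, 80384000),
   (-39581360, -234324960, 31811040), (-38842650, -273532266, -11210380),
   (-38103940, -312739572, -54231800), (-35230120, -341775144, -91701680),
   (-30734480, -362293968, -123902688), (-25066400, -375722656, -151135424),
   (-18615360, -383289152, -173713280), (-11715200, -386048640, -191957760),
   (-4815040, -388808128, -210202240), (2534240, -386760608, -224113344),
   (9998800, -380961264, -234012576), (17300440, -372292520, -240229552),
   (24212340, -361489948, -243097320), (30554550, -349164378, -242948140),
   (36896760, -336838808, -242798960), (42669280, -322990240, -239632832),
   (47692160, -308229504, -233782016), (51832320, -293042688, -225577984),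
   (54999040, -277813248, -215347200), (57139200, -262840320, -203407360),
   (59279360, -247867392, -191467520), (60392960, -233150976, -177818624),
   (60426880, -218990208, -162778368), (59365600, -205599904, -146655680),
   (57226440, -193128872, -129746960), (54054550, -181674426, -112332780),
   (50882660, -170219980, -94918600), (46678040, -159782120, -76998960),
   (41485840, -150458160, -58854432), (35379040, -142293920, -40749760),
   (28453440, -135298240, -22930560), (20822400, -129453696, -5620480),
   (13191360, -123609152, 11689600), (4854880, -118915744, 28490560),
   (-4073680, -115356048, 44558752), (-13463400, -112886376, 59692496),
   (-23171060, -111447492, 73714920), (-33046650, -110971530, 86476340),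
   (-42922240, -110495568, 99237760), (-52965760, -110982528, 110738176),
   (-63027200, -112364544, 120827904), (-72949760, -114565120, 129384448),
   (-82575360, -117506048, 136314880), (-91750400, -121110528, 141557760),
   (-100925440, -124715008, 146800640), (-109649920, -128983040, 150355968),
   (-117770240, -133837824, 152162304), (-125137280, -139203968, 152189696),
   (-131612160, -145010608, 150441600), (-137072250, -151190730, 146956340),
   (-142532340, -157370852, 143471080), (-146977640, -163924456, 138248656),
   (-150285520, -170784528, 131327392), (-152349600, -177887904, 122780480),
   (-153085760, -185174592, 112717440), (-152438400, -192583296, 101285120),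
   (-151791040, -199992000, 89852800), (-149760160, -207522720, 77051200),
   (-146290160, -215114160, 63027168), (-141353960, -222703720, 47964880),
   (-134959260, -230223020, 32086840), (-127155050, -237589626, 15654420),
   (-119350840, -244956232, -778000), (-110137120, -252170144, -17764800),
   (-99562880, -259148928, -35044608), (-87718400, -265796096, -52317184),
   (-74741760, -271992832, -69242880), (-60825600, -277585920, -85442560),
   (-46909440, -283179008, -101642240), (-32053760, -288168448, -117115904),
   (-16451200, -292401024, -131484416), (-348960, -295689120, -144329152),
   (15944440, -297798648, -155191920), (32052150, -298433178, -163575340),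
   (48159860, -299067708, -171958760), (64081880, -298227240, -177862832),
   (79441360, -295615344, -180790176), (93793120, -290873248, -180204224),
   (106616640, -283563968, -175529600), (117308800, -273152640, -166152960),
   (128000960, -262741312, -156776320), (136561760, -249227936, -142697664),
   (142388080, -232077648, -123303648), (144794200, -210657704, -97942960),
   (143004540, -184217812, -65927160), (136146150, -151866666, -26531980),
   (129287760, -119515520, 12863200), (117360640, -81253120, 59637760),
   (99491840, -36188160, 114515968), (74711040, 16711680, 178257920),
   (41943040, 78643200, 251658240), (0, 150994944, 335544320)]

/-- The edges of `K₀,₄` scaled by `2 ^ 24`. -/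
def K04edges : List ((ℤ × ℤ × ℤ) × (ℤ × ℤ × ℤ)) := K04verts.zip K04verts.tail

/-- The coordinates of an integer point, as a point of ℝ³. -/
def realPt (p : ℤ × ℤ × ℤ) : V3 := pt p.1 p.2.1 p.2.2

theorem smul_vertex_eq {m : ℕ} (hm : m < 97) :
    (2 ^ 24 : ℝ) • concatVerts 6 (subPolys 6 4 (vertsOf K0verts)) m =
      realPt (K04verts.getD m 0) := by
  have hx : Represents 1 0 (vertsOf K0verts) [0, -15, 40, -10, -60, 40, 0] :=
    ⟨rfl, fun i hi => by interval_cases i <;> simp [vertsOf, K0verts, pt]⟩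
  have hy : Represents 1 1 (vertsOf K0verts) [9, -95, 80, -60, 30, -60, 9] :=
    ⟨rfl, fun i hi => by interval_cases i <;> simp [vertsOf, K0verts, pt]⟩
  have hz : Represents 1 2 (vertsOf K0verts) [20, -50, -20, 58, 20, -60, 20] :=
    ⟨rfl, fun i hi => by interval_cases i <;> simp [vertsOf, K0verts, pt]⟩
  have key : ∀ m < 97,
      ((intSubPolys 4 [0, -15, 40, -10, -60, 40, 0]).getD (m % 96 / 6) []).getD (m % 96 % 6) 0
        = (K04verts.getD m 0).1 ∧
      ((intSubPolys 4 [9, -95, 80, -60, 30, -60, 9]).getD (m % 96 / 6) []).getD (m % 96 % 6) 0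
        = (K04verts.getD m 0).2.1 ∧
      ((intSubPolys 4 [20, -50, -20, 58, 20, -60, 20]).getD (m % 96 / 6) []).getD (m % 96 % 6) 0
        = (K04verts.getD m 0).2.2 := by
    decide +kernel
  obtain ⟨kx, ky, kz⟩ := key m hm
  have hne : subPolys 6 4 (vertsOf K0verts) ≠ [] := by simp [subPolys]
  have h24 : (2 ^ 24 : ℝ) = 1 * 64 ^ 4 := by norm_num
  ext j
  rw [Pi.smul_apply, smul_eq_mul, h24]
  fin_cases j
  · exact (mul_concatVerts_eq (hx.subPolys 4) hne m).trans (congrArg Int.cast kx)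
  · exact (mul_concatVerts_eq (hy.subPolys 4) hne m).trans (congrArg Int.cast ky)
  · exact (mul_concatVerts_eq (hz.subPolys 4) hne m).trans (congrArg Int.cast kz)

/-- The dot product of integer vectors. -/
def intDot (u v : ℤ × ℤ × ℤ) : ℤ := u.1 * v.1 + u.2.1 * v.2.1 + u.2.2 * v.2.2

/-- The determinant of three integer vectors. -/
def intDet (u v w : ℤ × ℤ × ℤ) : ℤ :=
  (u.2.1 * v.2.2 - u.2.2 * v.2.1) * w.1 + (u.2.2 * v.1 - u.1 * v.2.2) * w.2.1 +
    (u.1 * v.2.1 - u.2.1 * v.1) * w.2.2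

/-- The half-open segment `e` lies strictly below the half-open segment `f` in direction `w`. -/
def Below (w : ℤ × ℤ × ℤ) (e f : (ℤ × ℤ × ℤ) × (ℤ × ℤ × ℤ)) : Prop :=
  intDot w e.1 < intDot w f.1 ∧ intDot w e.1 < intDot w f.2 ∧
    intDot w e.2 ≤ intDot w f.1 ∧ intDot w e.2 ≤ intDot w f.2

instance (w : ℤ × ℤ × ℤ) (e f : (ℤ × ℤ × ℤ) × (ℤ × ℤ × ℤ)) : Decidable (Below w e f) :=
  inferInstanceAs (Decidable (_ ∧ _))

/-- A sufficient condition for the half-open segments `e` and `f` to be disjoint: either they lie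
on skew lines, or the sum of their directions separates them. -/
def Apart (e f : (ℤ × ℤ × ℤ) × (ℤ × ℤ × ℤ)) : Prop :=
  intDet (e.2 - e.1) (f.2 - f.1) (f.1 - e.1) ≠ 0 ∨
    Below (e.2 - e.1 + (f.2 - f.1)) e f ∨ Below (e.2 - e.1 + (f.2 - f.1)) f e

instance : DecidableRel Apart := fun _ _ => inferInstanceAs (Decidable (_ ∨ _))

/-- The point at parameter `s` on the segment `e`. -/
def segPt (e : (ℤ × ℤ × ℤ) × (ℤ × ℤ × ℤ)) (s : ℝ) : V3 :=
  (1 - s) • realPt e.1 + s • realPt e.2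

theorem segPt_eq_iff {e f : (ℤ × ℤ × ℤ) × (ℤ × ℤ × ℤ)} {s t : ℝ} :
    segPt e s = segPt f t ↔
      (1 - s) * e.1.1 + s * e.2.1 = (1 - t) * f.1.1 + t * f.2.1 ∧
      (1 - s) * e.1.2.1 + s * e.2.2.1 = (1 - t) * f.1.2.1 + t * f.2.2.1 ∧
      (1 - s) * e.1.2.2 + s * e.2.2.2 = (1 - t) * f.1.2.2 + t * f.2.2.2 := by
  simp [segPt, realPt, pt, funext_iff, Fin.forall_fin_succ]

theorem Below.segPt_ne {w : ℤ × ℤ × ℤ} {e f : (ℤ × ℤ × ℤ) × (ℤ × ℤ × ℤ)} (h : Below w e f)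
    {s t : ℝ} (hs : s ∈ Ico 0 1) (ht : t ∈ Ico 0 1) : segPt e s ≠ segPt f t := by
  intro heq
  obtain ⟨hx, hy, hz⟩ := segPt_eq_iff.1 heq
  have hdot : (1 - s) * (intDot w e.1 : ℝ) + s * (intDot w e.2 : ℝ) =
      (1 - t) * (intDot w f.1 : ℝ) + t * (intDot w f.2 : ℝ) := by
    push_cast [intDot]
    linear_combination w.1 * hx + w.2.1 * hy + w.2.2 * hz
  obtain ⟨h₁, h₂, h₃, h₄⟩ := h
  rify at h₁ h₂ h₃ h₄
  have ht' : 0 < 1 - t := sub_pos.2 ht.2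
  have hstart : (intDot w e.1 : ℝ) < (1 - t) * (intDot w f.1 : ℝ) + t * (intDot w f.2 : ℝ) := by
    nlinarith [mul_lt_mul_of_pos_left h₁ ht', mul_le_mul_of_nonneg_left h₂.le ht.1]
  have hend : (intDot w e.2 : ℝ) ≤ (1 - t) * (intDot w f.1 : ℝ) + t * (intDot w f.2 : ℝ) := by
    nlinarith [mul_le_mul_of_nonneg_left h₃ ht'.le, mul_le_mul_of_nonneg_left h₄ ht.1]
  nlinarith [mul_lt_mul_of_pos_left hstart (sub_pos.2 hs.2), mul_le_mul_of_nonneg_left hend hs.1]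

theorem Apart.segPt_ne {e f : (ℤ × ℤ × ℤ) × (ℤ × ℤ × ℤ)} (h : Apart e f)
    {s t : ℝ} (hs : s ∈ Ico 0 1) (ht : t ∈ Ico 0 1) : segPt e s ≠ segPt f t := by
  rcases h with h | h | h
  · refine fun heq => h ?_
    obtain ⟨hx, hy, hz⟩ := segPt_eq_iff.1 heq
    rify
    simp only [intDet, Prod.fst_sub, Prod.snd_sub]
    push_cast
    linear_combination
      (((f.2.2.1 : ℝ) - f.1.2.1) * (e.2.2.2 - e.1.2.2) -
        (f.2.2.2 - f.1.2.2) * (e.2.2.1 - e.1.2.1)) * hx +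
      (((f.2.2.2 : ℝ) - f.1.2.2) * (e.2.1 - e.1.1) -
        (f.2.1 - f.1.1) * (e.2.2.2 - e.1.2.2)) * hy +
      (((f.2.1 : ℝ) - f.1.1) * (e.2.2.1 - e.1.2.1) -
        (f.2.2.1 - f.1.2.1) * (e.2.1 - e.1.1)) * hz
  · exact h.segPt_ne hs ht
  · exact (h.segPt_ne ht hs).symm

theorem segPt_injective {e : (ℤ × ℤ × ℤ) × (ℤ × ℤ × ℤ)} (he : e.1 ≠ e.2) :
    Function.Injective (segPt e) := by
  intro s t heq
  obtain ⟨hx, hy, hz⟩ := segPt_eq_iff.1 heq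
  by_contra hst
  have hst' : s - t ≠ 0 := sub_ne_zero.2 hst
  refine he (Prod.ext ?_ (Prod.ext ?_ ?_)) <;> rify <;> apply mul_left_cancel₀ hst' <;> linarith

theorem K04edges_pairwise_apart : K04edges.Pairwise Apart := by
  decide +kernel

theorem K04edges_nondegenerate : ∀ e ∈ K04edges, e.1 ≠ e.2 := by
  decide +kernel

theorem exists_smul_Ksub_eq {x : ℝ} (hx : x ∈ Ico 0 1) :
    ∃ (i : ℕ) (hi : i < K04edges.length) (s : ℝ), s ∈ Ico 0 1 ∧ x * 96 = i + s ∧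
      (2 ^ 24 : ℝ) • Ksub 4 (vertsOf K0verts) x = segPt K04edges[i] s := by
  have h0 : 0 ≤ x * 96 := mul_nonneg hx.1 (by norm_num)
  have hi : ⌊x * 96⌋₊ < 96 := (Nat.floor_lt h0).2 (by push_cast; linarith [hx.2])
  refine ⟨⌊x * 96⌋₊, hi, x * 96 - ⌊x * 96⌋₊,
    ⟨sub_nonneg.2 (Nat.floor_le h0), by linarith [Nat.lt_floor_add_one (x * 96)]⟩, by ring, ?_⟩
  have hcast : x * ((6 * 2 ^ 4 : ℕ) : ℝ) = x * 96 := by norm_num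
  have hlen : K04verts.length = 97 := rfl
  simp only [Ksub, plPath, hcast, Int.floor_toNat, smul_add, smul_comm (2 ^ 24 : ℝ), segPt]
  rw [smul_vertex_eq (by lia), smul_vertex_eq (by lia),
    List.getD_eq_getElem _ _ (by lia), List.getD_eq_getElem _ _ (by lia)]
  simp [K04edges]

/-- The closed PL curve K₀,₄ (obtained from K₀ by 4 iterations of
de Casteljau subdivision at parameter 1/2) is a simple closed curve: its
standard loop parameterization is injective on `[0,1)`. -/
theorem K04_is_simple_closed : Set.InjOn (Ksub 4 (vertsOf K0verts)) (Ico 0 1) := by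
  intro x hx y hy hxy
  obtain ⟨i, hi, s, hs, hxs, hxe⟩ := exists_smul_Ksub_eq hx
  obtain ⟨j, hj, t, ht, hyt, hye⟩ := exists_smul_Ksub_eq hy
  have heq : segPt K04edges[i] s = segPt K04edges[j] t := by rw [← hxe, ← hye, hxy]
  have hpair := List.pairwise_iff_getElem.1 K04edges_pairwise_apart
  rcases lt_trichotomy i j with hij | rfl | hij
  · exact absurd heq ((hpair i j hi hj hij).segPt_ne hs ht)
  · have hst := segPt_injective (K04edges_nondegenerate _ (List.getElem_mem hi)) heq
    linarith
  · exact absurd heq.symm ((hpair j i hj hi hij).segPt_ne ht hs)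
end
end

section
/- Let P_0,…,P_n ∈ ℝ³ be control points such that for some coordinate index j ∈ {1,2,3} the j-th coordinates satisfy (P_i)_j < (P_{i+1})_j for all i = 0,…,n−1, let C be the associated Bézier curve, and let L be the control polygon, i.e., the piecewise linear curve interpolating P_0,…,P_n in order. Then there is an ambient isotopy between L and the image C([0,1]). -/
open Set Real

noncomputable section

/-- The extension of a curve on `[0,1]` to `ℝ` by rays in the direction of the `j`-th axis. -/
def rayExtend (j : Fin 3) (γ : ℝ → V3) (t : ℝ) : V3 :=
  γ (max 0 (min 1 t)) + Pi.single j (t - max 0 (min 1 t))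

lemma rayExtend_of_mem (j : Fin 3) (γ : ℝ → V3) {t : ℝ} (ht : t ∈ Icc (0 : ℝ) 1) :
    rayExtend j γ t = γ t := by
  simp [rayExtend, ht.1, ht.2]

lemma continuous_rayExtend (j : Fin 3) {γ : ℝ → V3} (hγ : ContinuousOn γ (Icc 0 1)) :
    Continuous (rayExtend j γ) := by
  have h : Continuous fun t : ℝ => γ (max 0 (min 1 t)) :=
    hγ.comp_continuous (by fun_prop) fun t => ⟨le_max_left _ _, max_le zero_le_one (min_le_left _ _)⟩
  have h' : Continuous fun t : ℝ => (Pi.single j (t - max 0 (min 1 t)) : V3) :=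
    (continuous_single (A := fun _ : Fin 3 => ℝ) j).comp (by fun_prop)
  exact h.add h'

lemma rayExtend_apply (j : Fin 3) (γ : ℝ → V3) (t : ℝ) :
    rayExtend j γ t j = γ (max 0 (min 1 t)) j + (t - max 0 (min 1 t)) := by
  simp [rayExtend]

lemma strictMono_rayExtend {j : Fin 3} {γ : ℝ → V3}
    (hmono : StrictMonoOn (fun t => γ t j) (Icc 0 1)) :
    StrictMono fun t => rayExtend j γ t j := by
  intro s t hst
  have hs : max 0 (min 1 s) ∈ Icc (0 : ℝ) 1 := ⟨by simp, by simp⟩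
  have ht : max 0 (min 1 t) ∈ Icc (0 : ℝ) 1 := ⟨by simp, by simp⟩
  have hle : max 0 (min 1 s) ≤ max 0 (min 1 t) := by gcongr
  simp only [rayExtend_apply]
  rcases hle.eq_or_lt with h | h
  · rw [h]
    linarith
  · have h₁ : γ (max 0 (min 1 s)) j < γ (max 0 (min 1 t)) j := hmono hs ht h
    have h₂ : s - max 0 (min 1 s) ≤ t - max 0 (min 1 t) := by grind
    linarith

lemma surjective_rayExtend {j : Fin 3} {γ : ℝ → V3} (hγ : ContinuousOn γ (Icc 0 1)) :
    Function.Surjective fun t => rayExtend j γ t j := by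
  apply Continuous.surjective ((continuous_apply j).comp (continuous_rayExtend j hγ))
  · refine Filter.tendsto_atTop_mono' _ ?_
      (Filter.tendsto_atTop_add_const_right _ (γ 1 j - 1) Filter.tendsto_id)
    filter_upwards [Filter.eventually_ge_atTop 1] with t ht
    simp [rayExtend_apply, min_eq_left ht]
    linarith
  · refine Filter.tendsto_atBot_mono' _ ?_
      (Filter.tendsto_atBot_add_const_right _ (γ 0 j) Filter.tendsto_id)
    filter_upwards [Filter.eventually_le_atBot 0] with t ht
    simp [rayExtend_apply, min_eq_right (ht.trans zero_le_one), max_eq_left ht, add_comm]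

/-- Sliding points in hyperplanes orthogonal to the `j`-th axis is an ambient isotopy. -/
lemma ambientIsotopic_image_shear {j : Fin 3} {D : ℝ → V3} (hD : Continuous D)
    (hDj : ∀ x, D x j = 0) (X : Set V3) :
    AmbientIsotopic X ((fun p => p + D (p j)) '' X) := by
  refine ⟨fun p t => p + t • D (p j), ?_, by simp, fun t _ => ?_, by simp⟩
  · apply Continuous.continuousOn
    fun_prop
  · refine ⟨⟨⟨fun p => p + t • D (p j), fun p => p - t • D (p j), fun p => ?_, fun p => ?_⟩,
      ?_, ?_⟩, fun x => rfl⟩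
    · simp [hDj]
    · simp [hDj]
    · fun_prop
    · fun_prop

/-- Two curves on `[0,1]` whose `j`-th coordinates are strictly increasing with the same initial
and final values have ambient isotopic images. -/
theorem ambientIsotopic_of_strictMonoOn_coord {j : Fin 3} {γ δ : ℝ → V3}
    (hγ : ContinuousOn γ (Icc 0 1)) (hδ : ContinuousOn δ (Icc 0 1))
    (hγj : StrictMonoOn (fun t => γ t j) (Icc 0 1))
    (hδj : StrictMonoOn (fun t => δ t j) (Icc 0 1))
    (h0 : γ 0 j = δ 0 j) (h1 : γ 1 j = δ 1 j) :
    AmbientIsotopic (γ '' Icc 0 1) (δ '' Icc 0 1) := by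
  let F : ℝ ≃o ℝ :=
    (strictMono_rayExtend hγj).orderIsoOfSurjective _ (surjective_rayExtend hγ)
  let G : ℝ ≃o ℝ :=
    (strictMono_rayExtend hδj).orderIsoOfSurjective _ (surjective_rayExtend hδ)
  have hF : ∀ t, F t = rayExtend j γ t j := fun t => rfl
  have hG : ∀ t, G t = rayExtend j δ t j := fun t => rfl
  let D : ℝ → V3 := fun x => rayExtend j δ (G.symm x) - rayExtend j γ (F.symm x)
  have hD : Continuous D :=
    ((continuous_rayExtend j hδ).comp G.symm.continuous).sub
      ((continuous_rayExtend j hγ).comp F.symm.continuous)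
  have hDj : ∀ x, D x j = 0 := fun x => by
    simp [D, ← hF, ← hG]
  have hm0 : (0 : ℝ) ∈ Icc (0 : ℝ) 1 := by simp
  have hm1 : (1 : ℝ) ∈ Icc (0 : ℝ) 1 := by simp
  have himage : (F.trans G.symm) '' Icc 0 1 = Icc 0 1 := by
    have e0 : G.symm (F 0) = 0 := by
      rw [OrderIso.symm_apply_eq, hF, hG, rayExtend_of_mem j γ hm0, rayExtend_of_mem j δ hm0, h0]
    have e1 : G.symm (F 1) = 1 := by
      rw [OrderIso.symm_apply_eq, hF, hG, rayExtend_of_mem j γ hm1, rayExtend_of_mem j δ hm1, h1]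
    rw [OrderIso.image_Icc]
    simp [e0, e1]
  have key : (fun p => p + D (p j)) '' (γ '' Icc 0 1) = δ '' Icc 0 1 := by
    conv_rhs => rw [← himage, image_image]
    rw [image_image]
    refine image_congr fun t ht => ?_
    have hmem : F.trans G.symm t ∈ Icc (0 : ℝ) 1 := himage ▸ mem_image_of_mem _ ht
    have hFt : γ t j = F t := by rw [hF, rayExtend_of_mem j γ ht]
    rw [← rayExtend_of_mem j δ hmem]
    simp [D, hFt, rayExtend_of_mem j γ ht]
  exact key ▸ ambientIsotopic_image_shear hD hDj _

/-- A polygonal path as a sum of the contributions of its edges. -/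
lemma polygon_eq_sum (P : ℕ → V3) (m : ℕ) {s : ℝ} (h0 : 0 ≤ s) (hs : s ≤ m) :
    (1 - (s - (⌊s⌋.toNat : ℕ))) • P ⌊s⌋.toNat + (s - (⌊s⌋.toNat : ℕ)) • P (⌊s⌋.toNat + 1) =
      P 0 + ∑ i ∈ Finset.range m, max 0 (min 1 (s - i)) • (P (i + 1) - P i) := by
  rw [Int.floor_toNat]
  induction m with
  | zero =>
    obtain rfl : s = 0 := le_antisymm (by simpa using hs) h0
    simp
  | succ m ih =>
    rw [Finset.sum_range_succ]
    rcases le_or_gt s m with h | h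
    · rw [ih h, min_eq_right (by linarith), max_eq_left (by linarith)]
      simp
    · have hsum : ∑ i ∈ Finset.range m, max 0 (min 1 (s - i)) • (P (i + 1) - P i) = P m - P 0 := by
        rw [← Finset.sum_range_sub]
        refine Finset.sum_congr rfl fun i hi => ?_
        have hi' : (i : ℝ) + 1 ≤ m := by exact_mod_cast Finset.mem_range.1 hi
        rw [min_eq_left (by linarith)]
        simp
      push_cast at hs
      rw [hsum, min_eq_right (by linarith), max_eq_right (by linarith)]
      rcases hs.eq_or_lt with rfl | h'
      · have : ⌊(m : ℝ) + 1⌋₊ = m + 1 := by exact_mod_cast Nat.floor_natCast (R := ℝ) (m + 1)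
        rw [this]
        push_cast
        simp
      · have : ⌊s⌋₊ = m := (Nat.floor_eq_iff h0).2 ⟨h.le, h'⟩
        rw [this]
        module

lemma plPath_eq_sum (P : ℕ → V3) (m : ℕ) {t : ℝ} (ht : t ∈ Icc (0 : ℝ) 1) :
    plPath P m t =
      P 0 + ∑ i ∈ Finset.range m, max 0 (min 1 (t * m - i)) • (P (i + 1) - P i) :=
  polygon_eq_sum P m (mul_nonneg ht.1 m.cast_nonneg) (mul_le_of_le_one_left m.cast_nonneg ht.2)

lemma continuousOn_plPath (P : ℕ → V3) (m : ℕ) : ContinuousOn (plPath P m) (Icc 0 1) := by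
  refine ContinuousOn.congr (Continuous.continuousOn ?_) fun t ht => plPath_eq_sum P m ht
  fun_prop

lemma plPath_zero (P : ℕ → V3) (m : ℕ) : plPath P m 0 = P 0 := by
  simp [plPath]

lemma plPath_one (P : ℕ → V3) (m : ℕ) : plPath P m 1 = P m := by
  simp [plPath]

lemma strictMonoOn_plPath {P : ℕ → V3} {m : ℕ} {j : Fin 3}
    (hmono : ∀ i < m, P i j < P (i + 1) j) (hm : 0 < m) :
    StrictMonoOn (fun t => plPath P m t j) (Icc 0 1) := by
  intro s hs t ht hst
  have hm' : (0 : ℝ) < m := by exact_mod_cast hm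
  have hlt : s * m < t * m := by gcongr
  have htm : t * m ≤ m := mul_le_of_le_one_left hm'.le ht.2
  have hs0 : 0 ≤ s * m := mul_nonneg hs.1 hm'.le
  simp only [plPath_eq_sum P m hs, plPath_eq_sum P m ht, Pi.add_apply, Finset.sum_apply,
    Pi.smul_apply, Pi.sub_apply, smul_eq_mul]
  gcongr 1
  refine Finset.sum_lt_sum (fun i hi => ?_) ⟨⌊s * m⌋₊, ?_, ?_⟩
  · have := hmono i (Finset.mem_range.1 hi)
    gcongr
  · rw [Finset.mem_range, Nat.floor_lt hs0]
    linarith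
  · have hk : ⌊s * m⌋₊ < m := by
      rw [Nat.floor_lt hs0]
      linarith
    have hpos := hmono _ hk
    have h₁ := Nat.floor_le hs0
    have h₂ := Nat.lt_floor_add_one (s * m)
    refine mul_lt_mul_of_pos_right ?_ (by linarith)
    rw [min_eq_right (by linarith : s * m - (⌊s * m⌋₊ : ℝ) ≤ 1), max_eq_right (by linarith)]
    exact lt_max_of_lt_right (lt_min (by linarith) (by linarith))

open Polynomial in
/-- The derivative of a polynomial in Bernstein form. -/
lemma derivative_sum_bernsteinPolynomial (m : ℕ) (p : ℕ → ℝ) :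
    derivative (∑ i ∈ Finset.range (m + 2), C (p i) * bernsteinPolynomial ℝ (m + 1) i) =
      (m + 1) * ∑ i ∈ Finset.range (m + 1), C (p (i + 1) - p i) * bernsteinPolynomial ℝ m i := by
  have hlast : ∑ i ∈ Finset.range (m + 1), C (p (i + 1)) * bernsteinPolynomial ℝ m (i + 1) =
      (∑ i ∈ Finset.range (m + 1), C (p i) * bernsteinPolynomial ℝ m i) -
        C (p 0) * bernsteinPolynomial ℝ m 0 := by
    rw [eq_sub_iff_add_eq,
      ← Finset.sum_range_succ' (fun i => C (p i) * bernsteinPolynomial ℝ m i),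
      Finset.sum_range_succ, bernsteinPolynomial.eq_zero_of_lt ℝ (Nat.lt_succ_self m)]
    simp
  rw [Finset.sum_range_succ', derivative_add, derivative_sum]
  simp only [derivative_C_mul, bernsteinPolynomial.derivative_zero,
    bernsteinPolynomial.derivative_succ, Nat.add_sub_cancel, map_sub, sub_mul,
    Finset.sum_sub_distrib, mul_sub, mul_left_comm (C _), ← Finset.mul_sum, hlast]
  push_cast
  ring

lemma bezier_apply (n : ℕ) (P : ℕ → V3) (j : Fin 3) (t : ℝ) :
    bezier n P t j = (∑ i ∈ Finset.range (n + 1),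
      Polynomial.C (P i j) * bernsteinPolynomial ℝ n i).eval t := by
  simp [bezier, bernsteinPolynomial, Polynomial.eval_finsetSum, mul_comm]

lemma continuous_bezier (n : ℕ) (P : ℕ → V3) : Continuous (bezier n P) := by
  unfold bezier
  fun_prop

lemma bezier_zero (n : ℕ) (P : ℕ → V3) : bezier n P 0 = P 0 := by
  rw [bezier, Finset.sum_range_succ']
  simp

lemma bezier_one (n : ℕ) (P : ℕ → V3) : bezier n P 1 = P n := by
  rw [bezier, Finset.sum_range_succ, Finset.sum_eq_zero]
  · simp
  · intro i hi
    simp [zero_pow (Nat.sub_pos_of_lt (Finset.mem_range.1 hi)).ne']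

lemma strictMonoOn_bezier {P : ℕ → V3} {n : ℕ} {j : Fin 3}
    (hmono : ∀ i < n, P i j < P (i + 1) j) (hn : 0 < n) :
    StrictMonoOn (fun t => bezier n P t j) (Icc 0 1) := by
  obtain ⟨m, rfl⟩ := Nat.exists_eq_succ_of_ne_zero hn.ne'
  simp only [bezier_apply]
  refine strictMonoOn_of_deriv_pos (convex_Icc 0 1) (Polynomial.continuousOn _) fun t ht => ?_
  rw [interior_Icc] at ht
  have ht' : 0 < 1 - t := by linarith [ht.2]
  rw [Polynomial.deriv, derivative_sum_bernsteinPolynomial, Polynomial.eval_mul,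
    Polynomial.eval_finsetSum]
  refine mul_pos ?_ (Finset.sum_pos (fun i hi => ?_) (by simp))
  · simp
    positivity
  · have hi' := Finset.mem_range.1 hi
    have hc : (0 : ℝ) < m.choose i := by exact_mod_cast Nat.choose_pos (Nat.lt_succ_iff.1 hi')
    have hp : 0 < P (i + 1) j - P i j := sub_pos.2 (hmono i hi')
    have h0 : 0 < t := ht.1
    simp only [bernsteinPolynomial, Polynomial.eval_mul, Polynomial.eval_C,
      Polynomial.eval_pow, Polynomial.eval_X, Polynomial.eval_sub, Polynomial.eval_one,
      Polynomial.eval_natCast]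
    positivity

/-- If the control points of a Bézier curve have strictly
increasing `j`-th coordinates, then the control polygon is ambient isotopic to
the image of the Bézier curve. -/
theorem controlPolygon_ambientIsotopic_bezier (n : ℕ) (P : ℕ → V3) (j : Fin 3)
    (hmono : ∀ i < n, P i j < P (i + 1) j) :
    AmbientIsotopic (plPath P n '' Icc 0 1) (bezier n P '' Icc 0 1) := by
  rcases n.eq_zero_or_pos with rfl | hn
  · have h : plPath P 0 = bezier 0 P := by
      ext t
      simp [plPath, bezier]
    rw [h]
    simpa using ambientIsotopic_image_shear (j := j) (D := fun _ => 0) continuous_const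
      (fun _ => rfl) (bezier 0 P '' Icc 0 1)
  · exact ambientIsotopic_of_strictMonoOn_coord (continuousOn_plPath P n)
      (continuous_bezier n P).continuousOn (strictMonoOn_plPath hmono hn)
      (strictMonoOn_bezier hmono hn) (by rw [plPath_zero, bezier_zero])
      (by rw [plPath_one, bezier_one])
end
end
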